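/- Let K be an infinite field and let p be a multilinear polynomial in m variables over K that is 2-central for M_n(K): p² takes only scalar values on M_n(K), p² does not vanish identically on M_n(K), and p does not take only scalar values on M_n(K). Then n = 2. -/

import Mathlib

/-- The multilinear polynomial with coefficients `c : S_m → K`, evaluated at an
`m`-tuple of `n×n` matrices: `(A_1,…,A_m) ↦ Σ_{σ ∈ S_m} c_σ · A_{σ(1)} ⋯ A_{σ(m)}`. -/
noncomputable def mlEval {K : Type*} [Field K] {m n : ℕ}
    (c : Equiv.Perm (Fin m) → K) (A : Fin m → Matrix (Fin n) (Fin n) K) :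
    Matrix (Fin n) (Fin n) K :=
  ∑ σ : Equiv.Perm (Fin m), c σ • (List.ofFn fun k => A (σ k)).prod

/-- The multilinear map underlying `mlEval`. -/
noncomputable def mlMap {K : Type*} [Field K] {m n : ℕ}
    (c : Equiv.Perm (Fin m) → K) :
    MultilinearMap K (fun _ : Fin m => Matrix (Fin n) (Fin n) K) (Matrix (Fin n) (Fin n) K) :=
  ∑ σ : Equiv.Perm (Fin m), c σ •
    (MultilinearMap.mkPiAlgebraFin K m (Matrix (Fin n) (Fin n) K)).domDomCongr σ

lemma mlMap_apply {K : Type*} [Field K] {m n : ℕ}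
    (c : Equiv.Perm (Fin m) → K) (A : Fin m → Matrix (Fin n) (Fin n) K) :
    mlMap c A = mlEval c A := by
  simp [mlMap, mlEval]

lemma mlEval_algHom {K : Type*} [Field K] {m n : ℕ}
    (c : Equiv.Perm (Fin m) → K) (A : Fin m → Matrix (Fin n) (Fin n) K)
    (φ : Matrix (Fin n) (Fin n) K →ₐ[K] Matrix (Fin n) (Fin n) K) :
    mlEval c (fun k => φ (A k)) = φ (mlEval c A) := by
  simp only [mlEval, map_sum, map_smul, map_list_prod, List.map_ofFn]
  rfl

/-- Matrices homogeneous of degree `g` for the cyclic grading. -/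
def homog (K : Type*) [Field K] {n : ℕ} [NeZero n] (g : Fin n) :
    Submodule K (Matrix (Fin n) (Fin n) K) where
  carrier := {M | ∀ a b, b ≠ a + g → M a b = 0}
  add_mem' := by
    intro x y hx hy a b h
    simp [hx a b h, hy a b h]
  zero_mem' := by intro a b _; rfl
  smul_mem' := by
    intro t x hx a b h
    simp [hx a b h]

lemma homog_one {K : Type*} [Field K] {n : ℕ} [NeZero n] :
    (1 : Matrix (Fin n) (Fin n) K) ∈ homog K (0 : Fin n) := by
  intro a b h
  apply Matrix.one_apply_ne
  intro hab
  exact h (by simp [hab])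

lemma homog_mul {K : Type*} [Field K] {n : ℕ} [NeZero n] {g h : Fin n}
    {M N : Matrix (Fin n) (Fin n) K} (hM : M ∈ homog K g) (hN : N ∈ homog K h) :
    M * N ∈ homog K (g + h) := by
  intro a b hab
  rw [Matrix.mul_apply]
  apply Finset.sum_eq_zero
  intro x _
  by_cases hx : x = a + g
  · rw [hN x b, mul_zero]
    intro hb
    apply hab
    rw [hb, hx, add_assoc]
  · rw [hM a x hx, zero_mul]

lemma homog_prod {K : Type*} [Field K] {n : ℕ} [NeZero n] (m : ℕ) (g : Fin m → Fin n)
    (A : Fin m → Matrix (Fin n) (Fin n) K) (hA : ∀ k, A k ∈ homog K (g k)) :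
    (List.ofFn A).prod ∈ homog K (∑ k, g k) := by
  induction m with
  | zero => simpa using homog_one
  | succ m ih =>
    rw [List.ofFn_succ, List.prod_cons, Fin.sum_univ_succ]
    exact homog_mul (hA 0) (ih _ _ fun k => hA k.succ)

lemma homog_mlEval {K : Type*} [Field K] {m n : ℕ} [NeZero n] (c : Equiv.Perm (Fin m) → K)
    (g : Fin m → Fin n)
    (A : Fin m → Matrix (Fin n) (Fin n) K) (hA : ∀ k, A k ∈ homog K (g k)) :
    mlEval c A ∈ homog K (∑ k, g k) := by
  refine Submodule.sum_mem _ fun σ _ => Submodule.smul_mem _ _ ?_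
  rw [← Equiv.sum_comp σ g]
  exact homog_prod m (fun k => g (σ k)) _ fun k => hA _

/-- Two multilinear forms that are not zero are simultaneously nonzero somewhere. -/
lemma both_ne {K : Type*} [Field K] [Infinite K] {m : ℕ} {V : Type*} [AddCommGroup V]
    [Module K V] (H : Fin m → Submodule K V)
    (f g : MultilinearMap K (fun _ : Fin m => V) K)
    (x y : Fin m → V) (hx : ∀ k, x k ∈ H k) (hy : ∀ k, y k ∈ H k)
    (hf : f x ≠ 0) (hg : g y ≠ 0) :
    ∃ z : Fin m → V, (∀ k, z k ∈ H k) ∧ f z ≠ 0 ∧ g z ≠ 0 := by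
  classical
  have key : ∀ s : Finset (Fin m), ∃ x y : Fin m → V, (∀ k, x k ∈ H k) ∧ (∀ k, y k ∈ H k) ∧
      f x ≠ 0 ∧ g y ≠ 0 ∧ ∀ k ∈ s, x k = y k := by
    intro s
    induction s using Finset.induction_on with
    | empty => exact ⟨x, y, hx, hy, hf, hg, by simp⟩
    | insert k s hk ih =>
      obtain ⟨x, y, hx, hy, hf, hg, hs⟩ := ih
      obtain ⟨t, ht⟩ := Infinite.exists_notMem_finset
        ({- (f x / f (Function.update x k (y k))), - (g (Function.update y k (x k)) / g y)} :
          Finset K)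
      simp only [Finset.mem_insert, Finset.mem_singleton, not_or] at ht
      refine ⟨Function.update x k (x k + t • y k), Function.update y k (x k + t • y k),
        ?_, ?_, ?_, ?_, ?_⟩
      · intro j
        by_cases hj : j = k
        · subst hj
          simpa using Submodule.add_mem _ (hx j) (Submodule.smul_mem _ t (hy j))
        · simpa [hj] using hx j
      · intro j
        by_cases hj : j = k
        · subst hj
          simpa using Submodule.add_mem _ (hx j) (Submodule.smul_mem _ t (hy j))
        · simpa [hj] using hy j
      · rw [f.map_update_add, f.map_update_smul, Function.update_eq_self, smul_eq_mul]
        intro h0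
        by_cases hz : f (Function.update x k (y k)) = 0
        · rw [hz, mul_zero, add_zero] at h0
          exact hf h0
        · apply ht.1
          field_simp
          linear_combination h0
      · rw [g.map_update_add, g.map_update_smul, Function.update_eq_self, smul_eq_mul]
        intro h0
        apply ht.2
        field_simp
        linear_combination h0
      · intro j hj
        by_cases hjk : j = k
        · subst hjk; simp
        · simp only [Function.update_of_ne hjk]
          exact hs j ((Finset.mem_insert.1 hj).resolve_left hjk)
  obtain ⟨x, y, hx, hy, hf, hg, h⟩ := key Finset.univ
  have : x = y := funext fun k => h k (Finset.mem_univ k)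
  subst this
  exact ⟨x, hx, hf, hg⟩

/-- Conjugation as an algebra homomorphism. -/
def conjHom {K : Type*} [Field K] {n : ℕ} (P Q : Matrix (Fin n) (Fin n) K)
    (hPQ : P * Q = 1) (hQP : Q * P = 1) :
    Matrix (Fin n) (Fin n) K →ₐ[K] Matrix (Fin n) (Fin n) K :=
  AlgHom.ofLinearMap
    { toFun := fun M => P * M * Q
      map_add' := by intro x y; rw [mul_add, add_mul]
      map_smul' := by intro t x; simp }
    (by simpa using hPQ)
    (by
      intro x y
      change P * (x * y) * Q = P * x * Q * (P * y * Q)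
      calc P * (x * y) * Q = P * x * 1 * (y * Q) := by simp only [mul_assoc, mul_one, one_mul]
        _ = _ := by rw [← hQP]; simp only [mul_assoc])

lemma exists_offdiag {K : Type*} [Field K] {m n : ℕ}
    (c : Equiv.Perm (Fin m) → K)
    (hns : ∃ A : Fin m → Matrix (Fin n) (Fin n) K,
      ∀ lam : K, mlEval c A ≠ lam • (1 : Matrix (Fin n) (Fin n) K)) :
    ∃ A : Fin m → Matrix (Fin n) (Fin n) K, ∃ i j, i ≠ j ∧ mlEval c A i j ≠ 0 := by
  by_contra! hcon
  obtain ⟨A, hA⟩ := hns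
  have hdiag : ∀ i j, mlEval c A i i = mlEval c A j j := by
    intro i j
    by_cases hij : i = j
    · rw [hij]
    have hE : Matrix.single i j (1 : K) * Matrix.single i j (1 : K) = 0 :=
      Matrix.single_mul_single_of_ne _ _ _ _ (Ne.symm hij) _
    have h := hcon (fun k => conjHom (1 + Matrix.single i j (1 : K)) (1 - Matrix.single i j (1 : K))
      (by rw [add_mul, mul_sub, mul_sub, hE]; simp)
      (by rw [sub_mul, mul_add, mul_add, hE]; simp) (A k)) i j hij
    rw [mlEval_algHom] at h
    change ((1 + Matrix.single i j (1 : K)) * mlEval c A * (1 - Matrix.single i j (1 : K))) i j = 0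
      at h
    have hij0 := hcon A i j hij
    have hji0 := hcon A j i (Ne.symm hij)
    simp [add_mul, mul_sub, hij0, hji0] at h
    linear_combination -h
  by_cases hn : Nonempty (Fin n)
  · obtain ⟨i0⟩ := hn
    apply hA (mlEval c A i0 i0)
    ext i j
    by_cases hij : i = j
    · subst hij
      simp [hdiag i i0]
    · simp [hij, hcon A i j hij]
  · apply hA 0
    ext i
    exact (hn ⟨i⟩).elim

/-- If `K` is an infinite field and the multilinear polynomial `p` is 2-central for
`M_n(K)` (`p²` takes only scalar values, `p²` does not vanish identically, and `p`
does not take only scalar values), then `n = 2`. -/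
theorem two_central_multilinear_n_eq_two
    {K : Type*} [Field K] [Infinite K] {m n : ℕ}
    (c : Equiv.Perm (Fin m) → K)
    (hsq : ∀ A : Fin m → Matrix (Fin n) (Fin n) K,
      ∃ lam : K, (mlEval c A) ^ 2 = lam • (1 : Matrix (Fin n) (Fin n) K))
    (hnz : ∃ A : Fin m → Matrix (Fin n) (Fin n) K, (mlEval c A) ^ 2 ≠ 0)
    (hns : ∃ A : Fin m → Matrix (Fin n) (Fin n) K,
      ∀ lam : K, mlEval c A ≠ lam • (1 : Matrix (Fin n) (Fin n) K)) :
    n = 2 := by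
  classical
  obtain ⟨A, i, j, hij, hA⟩ := exists_offdiag c hns
  match n, hsq, A, i, j, hij, hA with
  | 0, _, _, i, _, _, _ => exact i.elim0
  | 1, _, _, i, j, hij, _ => exact (hij (Subsingleton.elim i j)).elim
  | 2, _, _, _, _, _, _ => rfl
  | n + 3, hsq, A, i, j, hij, hA =>
    exfalso
    have h01 : (0 : Fin (n + 3)) ≠ 1 := by simp [Fin.ext_iff]
    -- move the nonzero entry to position (0, 1)
    obtain ⟨τ, hτ0, hτ1⟩ : ∃ τ : Equiv.Perm (Fin (n + 3)), τ 0 = i ∧ τ 1 = j := by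
      refine ⟨Equiv.swap (Equiv.swap 0 i 1) j * Equiv.swap 0 i, ?_, ?_⟩
      · rw [Equiv.Perm.mul_apply, Equiv.swap_apply_left]
        apply Equiv.swap_apply_of_ne_of_ne _ hij
        intro h
        have h2 : Equiv.swap 0 i 0 = Equiv.swap 0 i 1 := by
          rw [Equiv.swap_apply_left]; exact h
        exact h01 ((Equiv.swap 0 i).injective h2)
      · rw [Equiv.Perm.mul_apply, Equiv.swap_apply_left]
    have hre : ∀ (e : Equiv.Perm (Fin (n + 3)))
        (A : Fin m → Matrix (Fin (n + 3)) (Fin (n + 3)) K) (a b),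
        mlEval c (fun k => (A k).submatrix e e) a b = mlEval c A (e a) (e b) := by
      intro e A a b
      have h := mlEval_algHom c A (Matrix.reindexAlgEquiv K K e.symm).toAlgHom
      have h2 := congrFun (congrFun h a) b
      simpa using h2
    have hB := hre τ A 0 1
    rw [hτ0, hτ1] at hB
    rw [← hB] at hA
    generalize (fun k => (A k).submatrix τ τ) = B at hA
    -- homogeneous components
    let comp : Fin (n + 3) → Matrix (Fin (n + 3)) (Fin (n + 3)) K →
      Matrix (Fin (n + 3)) (Fin (n + 3)) K :=
      fun g M => Matrix.of fun a b => if b = a + g then M a b else 0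
    have hcomp : ∀ M, M = ∑ g, comp g M := by
      intro M
      ext a b
      rw [Matrix.sum_apply, Finset.sum_eq_single (b - a)]
      · simp [comp]
      · intro g _ hg
        simp only [comp, Matrix.of_apply]
        rw [if_neg]
        intro h
        apply hg
        rw [h]; simp
      · simp
    have hcm : ∀ g M, comp g M ∈ homog K g := by
      intro g M a b h
      simp [comp, h]
    have hsum : mlEval c B = ∑ r : Fin m → Fin (n + 3), mlEval c (fun k => comp (r k) (B k)) := by
      rw [← mlMap_apply]
      conv_lhs => rw [show B = fun k => ∑ g, comp g (B k) from funext fun k => hcomp _]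
      rw [MultilinearMap.map_sum]
      simp only [mlMap_apply]
    obtain ⟨r, hr⟩ : ∃ r : Fin m → Fin (n + 3),
        mlEval c (fun k => comp (r k) (B k)) 0 1 ≠ 0 := by
      by_contra! h
      apply hA
      rw [hsum, Matrix.sum_apply]
      exact Finset.sum_eq_zero fun r _ => h r
    have hdeg : ∑ k, r k = 1 := by
      by_contra h
      exact hr (homog_mlEval c r _ (fun k => hcm _ _) 0 1 (by simpa using Ne.symm h))
    let F : Fin (n + 3) → Fin (n + 3) →
        MultilinearMap K (fun _ : Fin m => Matrix (Fin (n + 3)) (Fin (n + 3)) K) K :=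
      fun a b => (Matrix.entryLinearMap K K a b).compMultilinearMap (mlMap c)
    have hF : ∀ a b A, F a b A = mlEval c A a b := by
      intro a b A
      simp [F, mlMap_apply]
    have hr2 := hre (Equiv.subRight 1) (fun k => comp (r k) (B k)) 1 2
    have e1 : (Equiv.subRight (1 : Fin (n + 3))) 1 = 0 := by simp
    have e2 : (Equiv.subRight (1 : Fin (n + 3))) 2 = 1 := by
      rw [Equiv.subRight_apply, sub_eq_iff_eq_add]; ext; simp [Fin.val_add]
    rw [e1, e2] at hr2
    rw [← hr2] at hr
    obtain ⟨Z, hZ, hz1, hz2⟩ := both_ne (fun k => homog K (r k)) (F 0 1) (F 1 2)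
      (fun k => comp (r k) (B k))
      (fun k => (comp (r k) (B k)).submatrix (Equiv.subRight 1) (Equiv.subRight 1))
      (fun k => hcm _ _)
      (by
        intro k a b hab
        rw [Matrix.submatrix_apply]
        apply hcm
        intro h
        apply hab
        simp only [Equiv.subRight_apply] at h
        rw [sub_eq_iff_eq_add.1 h, add_right_comm, sub_add_cancel])
      (by rw [hF, ← hr2]; exact hr) (by rw [hF]; exact hr)
    rw [hF] at hz1 hz2
    have hX := homog_mlEval c r Z hZ
    rw [hdeg] at hX
    obtain ⟨lam, hlam⟩ := hsq Z
    have h02 : (0 : Fin (n + 3)) ≠ 2 := by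
      intro h
      have h' := congrArg Fin.val h
      have h2 : ((2 : Fin (n + 3)) : ℕ) = 2 := Nat.mod_eq_of_lt (by omega : 2 < n + 3)
      rw [h2] at h'
      simp at h'
    have hent := congrFun (congrFun hlam 0) 2
    rw [sq, Matrix.mul_apply, Finset.sum_eq_single 1] at hent
    · simp [h02, hz1, hz2] at hent
    · intro b _ hb
      rw [hX 0 b (by simpa using hb), zero_mul]
    · simp
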